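/- arXiv:2509.13796 — 2 statements merged into one kernel-verified Lean document; each statement's English description precedes it below -/
import Mathlib

section
/- For every even integer h ≥ 4, the Laurent series T_h ∈ ℚ((q)) has order exactly −r(h) with leading coefficient c_{h,r(h)} = 1, and its constant term c_{h,0} is nonzero (so that the Siegel coefficients b_j(h) = −c_{h,j}/c_{h,0} are well defined for 1 ≤ j ≤ r(h)). -/
open scoped Classical
noncomputable section

/-- `Δ = q·∏_{n≥1}(1 − q^n)^24` as a formal power series: its `N`-th coefficient is the
(stable) `N`-th coefficient of the partial product `q·∏_{n=1}^{N+1}(1 − q^n)^24`. -/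
def Delta : PowerSeries ℚ :=
  PowerSeries.mk fun N => PowerSeries.coeff (R := ℚ) N
    (PowerSeries.X * ∏ n ∈ Finset.range (N + 1), (1 - PowerSeries.X ^ (n + 1)) ^ 24)

/-- The Eisenstein series `G_k = 1 − (2k/B_k)·∑_{n≥1} σ_{k−1}(n) q^n` (with `G_0 = 1`). -/
def Gser (k : ℕ) : PowerSeries ℚ :=
  PowerSeries.mk fun n =>
    if n = 0 then 1
    else -(2 * (k : ℚ) / bernoulli k) * ∑ d ∈ n.divisors, (d : ℚ) ^ (k - 1)

/-- `r(h) = ⌊h/12⌋` if `h ≡ 2 (mod 12)` and `⌊h/12⌋ + 1` otherwise. -/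
def rS (h : ℕ) : ℕ := if h % 12 = 2 then h / 12 else h / 12 + 1

/-- `T_h = G_{12·r(h) − h + 2} · Δ^{−r(h)}` as a formal Laurent series over `ℚ`. -/
def Tq (h : ℕ) : LaurentSeries ℚ :=
  (HahnSeries.ofPowerSeries ℤ ℚ (Gser (12 * rS h + 2 - h))) *
    (HahnSeries.ofPowerSeries ℤ ℚ Delta) ^ (-(rS h : ℤ))

/-- `c_{h,j}`, the coefficient of `q^{−j}` in `T_h`. -/
def cCoeff (h j : ℕ) : ℚ := (Tq h).coeff (-(j : ℤ))

section

open UpperHalfPlane ModularForm ModularFormClass MatrixGroups EisensteinSeries Derivative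
open Function.Periodic (qParam)

lemma hasSum_mul_powerSeries {f g : PowerSeries ℂ} {q a b : ℂ}
    (hf : HasSum (fun m ↦ f.coeff m * q ^ m) a) (hg : HasSum (fun m ↦ g.coeff m * q ^ m) b) :
    HasSum (fun m ↦ (f * g).coeff m * q ^ m) (a * b) := by
  have hf' := hf.summable.norm
  have hg' := hg.summable.norm
  have h := summable_norm_sum_mul_antidiagonal_of_summable_norm hf' hg'
  have h2 := tsum_mul_tsum_eq_tsum_sum_antidiagonal_of_summable_norm hf' hg'
  rw [hf.tsum_eq, hg.tsum_eq] at h2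
  have h3 := h.of_norm.hasSum
  rw [← h2] at h3
  convert! h3 using 2 with m
  rw [PowerSeries.coeff_mul, Finset.sum_mul]
  refine Finset.sum_congr rfl fun p hp ↦ ?_
  rw [← Finset.HasAntidiagonal.mem_antidiagonal.mp hp, pow_add]
  ring

/-- The Euler operator `q d/dq` on power series. -/
def eulerOp {R : Type*} [CommRing R] (f : PowerSeries R) : PowerSeries R :=
  PowerSeries.X * PowerSeries.derivative R f

lemma coeff_eulerOp {R : Type*} [CommRing R] (f : PowerSeries R) (n : ℕ) :
    (eulerOp f).coeff n = n * f.coeff n := by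
  rcases n with _ | n
  · simp [eulerOp]
  · rw [eulerOp, PowerSeries.coeff_succ_X_mul, PowerSeries.coeff_derivative]
    push_cast
    ring

lemma hasSum_normalizedDeriv {k : ℤ} (f : ModularForm 𝒮ℒ k) (τ : ℍ) :
    HasSum (fun m ↦ (eulerOp (qExpansion 1 f)).coeff m * qParam 1 τ ^ m)
      (normalizedDerivOfComplex f τ) := by
  set g := cuspFunction 1 f with hg
  have hgd : DifferentiableOn ℂ g (Metric.ball 0 1) := fun q hq ↦
    (ModularFormClass.differentiableAt_cuspFunction f one_pos one_mem_strictPeriods_SL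
      (by simpa using hq)).differentiableWithinAt
  have hq : qParam 1 τ ∈ Metric.ball (0 : ℂ) 1 := by
    simpa using Function.Periodic.norm_qParam_lt_one one_pos τ.im_pos
  have hD : normalizedDerivOfComplex f τ = qParam 1 τ * deriv g (qParam 1 τ) := by
    have hev : (f ∘ ofComplex) =ᶠ[nhds (τ : ℂ)] fun w ↦ g (qParam 1 w) := by
      filter_upwards [isOpen_upperHalfPlaneSet.mem_nhds τ.im_pos] with w hw
      have := SlashInvariantFormClass.eq_cuspFunction f (⟨w, hw⟩ : ℍ)
        one_mem_strictPeriods_SL one_ne_zero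
      rw [Function.comp_apply, ofComplex_apply_of_im_pos hw, ← this]
    have hd : HasDerivAt (fun w ↦ g (qParam 1 w))
        (deriv g (qParam 1 τ) * (qParam 1 τ * (2 * Real.pi * Complex.I))) τ := by
      refine HasDerivAt.comp (τ : ℂ)
        ((hgd.differentiableAt (Metric.isOpen_ball.mem_nhds hq)).hasDerivAt) ?_
      have hfun : qParam 1 = fun w ↦ Complex.exp (2 * Real.pi * Complex.I * w) := by
        ext w; simp [qParam]
      rw [hfun]
      have := (((hasDerivAt_id (τ : ℂ)).const_mul (2 * Real.pi * Complex.I)).div_const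
        ((1 : ℝ) : ℂ)).cexp
      simpa using this
    rw [normalizedDerivOfComplex, hev.deriv_eq, hd.deriv]
    field_simp [Real.pi_ne_zero, Complex.I_ne_zero]
  have h := (Complex.hasSum_taylorSeries_on_ball (hgd.deriv Metric.isOpen_ball) hq).mul_left
    (qParam 1 τ)
  rw [← hD] at h
  rw [← hasSum_nat_add_iff' 1]
  convert! h using 2 with m
  · rw [coeff_eulerOp, qExpansion_coeff, ← hg, iteratedDeriv_succ', Nat.factorial_succ]
    have := Nat.factorial_ne_zero m
    simp only [smul_eq_mul, sub_zero]
    push_cast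
    field_simp
    ring
  · simp [coeff_eulerOp]

lemma modularForm_eq_of_coeff_eq {k : ℕ} (f g : ModularForm 𝒮ℒ (k : ℤ))
    (h : ∀ i ≤ k / 12, (qExpansion 1 f).coeff i = (qExpansion 1 g).coeff i) : f = g := by
  rw [← sub_eq_zero]
  apply sturm_bound_levelOne_nat
  refine (ENat.natCast_lt_natCast.mpr (Nat.lt_succ_self _)).trans_le (PowerSeries.nat_le_order _ _ ?_)
  intro i hi
  rw [FunLike.coe_sub, ModularForm.qExpansion_sub one_pos one_mem_strictPeriods_SL, map_sub,
    h i (by omega), sub_self]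

/-- The `q`-expansion of the weight two Eisenstein series. -/
def E2series (R : Type*) [Ring R] : PowerSeries R :=
  .mk fun m ↦ if m = 0 then 1 else -24 * (ArithmeticFunction.sigma 1 m : R)

/-- The `q`-expansion of the Serre derivative of a modular form. -/
lemma hasSum_serreDerivative {k : ℤ} (f : ModularForm 𝒮ℒ k) (τ : ℍ) :
    HasSum (fun m ↦ (eulerOp (qExpansion 1 f) -
      PowerSeries.C ((k : ℂ) * 12⁻¹) * (E2series ℂ * qExpansion 1 f)).coeff m * qParam 1 τ ^ m)
      (serreDerivative k f τ) := by
  have : Fact (IsCusp OnePoint.infty 𝒮ℒ) :=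
    ⟨Subgroup.isCusp_of_mem_strictPeriods one_pos one_mem_strictPeriods_SL⟩
  have hE2 : HasSum (fun m ↦ (E2series ℂ).coeff m * qParam 1 τ ^ m) (E2 τ) := by
    simpa [E2series, qParam] using hasSum_qExpansion_E2 τ
  have hf := hasSum_qExpansion f one_pos one_mem_strictPeriods_SL τ
  have h := (hasSum_normalizedDeriv f τ).sub
    ((hasSum_mul_powerSeries hE2 hf).mul_left ((k : ℂ) * 12⁻¹))
  rw [serreDerivative_apply]
  convert! h using 2 with m
  · rw [map_sub, PowerSeries.coeff_C_mul]
    ring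
  · ring

/-- The Serre derivative of a level one modular form, as a modular form. -/
def serreDerivativeForm {k : ℤ} (f : ModularForm 𝒮ℒ k) : ModularForm 𝒮ℒ (k + 2) where
  toFun := serreDerivative k f
  slash_action_eq' := by
    rintro _ ⟨γ, rfl⟩
    exact serreDerivative_slash_invariant f.holo' (f.slash_action_eq' _ ⟨γ, rfl⟩)
  holo' := serreDerivative_mdifferentiable _ f.holo'
  bdd_at_cusps' {c} hc := by
    rw [Subgroup.IsArithmetic.isCusp_iff_isCusp_SL2Z] at hc
    rw [OnePoint.isBoundedAt_iff_forall_SL2Z hc]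
    intro γ _
    have hinv : serreDerivative k f ∣[k + 2] γ = serreDerivative k f :=
      serreDerivative_slash_invariant f.holo' (f.slash_action_eq' _ ⟨γ, rfl⟩)
    rw [hinv]
    exact isBoundedAtImInfty_of_hasSum_qExpansion one_pos (hasSum_serreDerivative f)

lemma qExpansion_serreDerivativeForm {k : ℤ} (f : ModularForm 𝒮ℒ k) :
    qExpansion 1 (serreDerivativeForm f) = eulerOp (qExpansion 1 f) -
      PowerSeries.C ((k : ℂ) * 12⁻¹) * (E2series ℂ * qExpansion 1 f) := by
  ext m
  exact (ModularFormClass.qExpansion_coeff_unique one_pos one_mem_strictPeriods_SL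
    (f := serreDerivativeForm f) (hasSum_serreDerivative f) m).symm

lemma map_Gser {k : ℕ} (hk : 3 ≤ k) (hk2 : Even k) :
    (Gser k).map (algebraMap ℚ ℂ) = qExpansion 1 (E hk) := by
  ext m
  rw [PowerSeries.coeff_map, E_qExpansion_coeff hk hk2, Gser, PowerSeries.coeff_mk]
  split_ifs
  · simp
  · simp [ArithmeticFunction.sigma_apply]

lemma map_E2series : (E2series ℚ).map (algebraMap ℚ ℂ) = E2series ℂ := by
  ext m
  simp only [E2series, PowerSeries.coeff_map, PowerSeries.coeff_mk]
  split_ifs <;> simp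

lemma map_eulerOp (f : PowerSeries ℚ) :
    (eulerOp f).map (algebraMap ℚ ℂ) = eulerOp (f.map (algebraMap ℚ ℂ)) := by
  ext m
  simp [coeff_eulerOp]

/-- The level one Sturm bound, for rational power series that are `q`-expansions. -/
lemma eq_of_map_eq_qExpansion {k : ℕ} (f g : ModularForm 𝒮ℒ (k : ℤ)) {F G : PowerSeries ℚ}
    (hF : F.map (algebraMap ℚ ℂ) = qExpansion 1 f) (hG : G.map (algebraMap ℚ ℂ) = qExpansion 1 g)
    (h : ∀ i ≤ k / 12, F.coeff i = G.coeff i) : F = G := by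
  refine PowerSeries.map_injective _ (algebraMap ℚ ℂ).injective ?_
  rw [hF, hG, modularForm_eq_of_coeff_eq f g fun i hi ↦ ?_]
  rw [← hF, ← hG, PowerSeries.coeff_map, PowerSeries.coeff_map, h i hi]

lemma constantCoeff_Gser (k : ℕ) : (Gser k).constantCoeff = 1 := by
  simp [Gser, ← PowerSeries.coeff_zero_eq_constantCoeff_apply]

lemma Gser_coeff_one (k : ℕ) : (Gser k).coeff 1 = -(2 * (k : ℚ) / bernoulli k) := by simp [Gser]

lemma Gser_six : Gser 6 = Gser 4 * E2series ℚ - (3 : ℚ) • eulerOp (Gser 4) := by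
  refine eq_of_map_eq_qExpansion (k := 6) E₆ ((-3 : ℂ) • serreDerivativeForm E₄)
    (map_Gser _ ⟨3, rfl⟩) ?_ fun i hi ↦ ?_
  · rw [FunLike.coe_smul, ModularForm.qExpansion_smul one_pos one_mem_strictPeriods_SL,
      qExpansion_serreDerivativeForm, ← map_Gser (k := 4) _ ⟨2, rfl⟩, ← map_E2series, ← map_eulerOp]
    ext m
    have hc : ((4 : ℤ) : ℂ) * 12⁻¹ = 3⁻¹ := by norm_num
    rw [hc, mul_comm (Gser 4)]
    simp only [map_sub, map_mul, PowerSeries.coeff_smul,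
      PowerSeries.coeff_C_mul, PowerSeries.coeff_map, smul_eq_mul]
    simp
    ring
  · obtain rfl : i = 0 := by omega
    simp [constantCoeff_Gser, E2series, eulerOp]

lemma Gser_ten : Gser 10 = Gser 4 * Gser 6 := by
  refine eq_of_map_eq_qExpansion (k := 10) (E (k := 10) (by norm_num)) (E₄.mul E₆)
    (map_Gser _ ⟨5, rfl⟩) ?_ fun i hi ↦ ?_
  · rw [map_mul, map_Gser (by norm_num) ⟨2, rfl⟩, map_Gser (by norm_num) ⟨3, rfl⟩]
    exact (ModularForm.qExpansion_mul one_pos one_mem_strictPeriods_SL E₄ E₆).symm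
  · obtain rfl : i = 0 := by omega
    simp [constantCoeff_Gser]

lemma bernoulli_fourteen : bernoulli 14 = 7 / 6 := by
  have hodd (n : ℕ) : bernoulli (2 * n + 3) = 0 :=
    bernoulli_eq_zero_of_odd ⟨n + 1, by ring⟩ (by omega)
  have h3 : bernoulli 3 = 0 := hodd 0
  have h5 : bernoulli 5 = 0 := hodd 1
  have h7 : bernoulli 7 = 0 := hodd 2
  have h9 : bernoulli 9 = 0 := hodd 3
  have h11 : bernoulli 11 = 0 := hodd 4
  have h13 : bernoulli 13 = 0 := hodd 5
  have h4 := sum_bernoulli 5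
  have h6 := sum_bernoulli 7
  have h8 := sum_bernoulli 9
  have h10 := sum_bernoulli 11
  have h12 := sum_bernoulli 13
  have h14 := sum_bernoulli 15
  norm_num [Finset.sum_range_succ, Nat.choose, h3, h5, h7, h9, h11, h13]
    at h4 h6 h8 h10 h12 h14
  linarith

lemma Gser_fourteen : Gser 14 = Gser 4 ^ 2 * Gser 6 := by
  refine eq_of_map_eq_qExpansion (k := 14) (E (k := 14) (by norm_num)) (E₄.mul (E₄.mul E₆))
    (map_Gser _ ⟨7, rfl⟩) ?_ fun i hi ↦ ?_
  · rw [map_mul, map_pow, map_Gser (by norm_num) ⟨2, rfl⟩, map_Gser (by norm_num) ⟨3, rfl⟩, sq,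
      mul_assoc, ← ModularForm.qExpansion_mul one_pos one_mem_strictPeriods_SL E₄ E₆]
    exact (ModularForm.qExpansion_mul one_pos one_mem_strictPeriods_SL E₄ (E₄.mul E₆)).symm
  · interval_cases i
    · simp [constantCoeff_Gser]
    · norm_num [sq, PowerSeries.coeff_mul, Finset.Nat.antidiagonal_succ, constantCoeff_Gser,
        Gser_coeff_one, show bernoulli 4 = -1 / 30 by decide +kernel,
        show bernoulli 6 = 1 / 42 by decide +kernel, bernoulli_fourteen]

lemma eulerOp_mul {R : Type*} [CommRing R] (f g : PowerSeries R) :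
    eulerOp (f * g) = eulerOp f * g + f * eulerOp g := by
  simp only [eulerOp, Derivation.leibniz, smul_eq_mul]
  ring

lemma eulerOp_pow_succ {R : Type*} [CommRing R] (f : PowerSeries R) (n : ℕ) :
    eulerOp (f ^ (n + 1)) = (n + 1) * (f ^ n * eulerOp f) := by
  simp only [eulerOp, Derivation.leibniz_pow, smul_eq_mul, nsmul_eq_mul, Nat.add_sub_cancel]
  push_cast
  ring

lemma eulerOp_one {R : Type*} [CommRing R] : eulerOp (1 : PowerSeries R) = 0 := by
  simp [eulerOp]

/-- The Lambert series `∑_{m ≥ 1} n q^{nm} = n q^n / (1 - q^n)`. -/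
def lambertTerm (n : ℕ) : PowerSeries ℚ :=
  .mk fun m ↦ if n ∣ m ∧ m ≠ 0 then (n : ℚ) else 0

lemma eulerOp_one_sub_X_pow {n : ℕ} (hn : n ≠ 0) :
    eulerOp (1 - PowerSeries.X ^ n : PowerSeries ℚ) =
      -((1 - PowerSeries.X ^ n) * lambertTerm n) := by
  ext m
  rw [coeff_eulerOp, map_neg, sub_mul, one_mul, map_sub, map_sub, PowerSeries.coeff_X_pow_mul',
    PowerSeries.coeff_X_pow, PowerSeries.coeff_one]
  simp only [lambertTerm, PowerSeries.coeff_mk]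
  rcases lt_trichotomy m n with h | rfl | h
  · have : n ∣ m → m = 0 := fun hd ↦ Nat.eq_zero_of_dvd_of_lt hd h
    have hm : ¬ n ≤ m := by omega
    have hm' : m ≠ n := by omega
    have hnm : ¬ (n ∣ m ∧ m ≠ 0) := by tauto
    simp only [hm, hm', hnm, if_false]
    split_ifs with h0 <;> simp [h0]
  · simp [hn]
  · have hd : n ∣ m - n ↔ n ∣ m := by
      rw [Nat.dvd_sub_iff_left h.le dvd_rfl]
    have h1 : m ≠ 0 := by omega
    have h2 : m - n ≠ 0 := by omega
    simp [hd, h1, h2, h.le, h.ne']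

lemma eulerOp_prod_one_sub_X_pow (M : ℕ) :
    eulerOp (∏ n ∈ Finset.range M, (1 - PowerSeries.X ^ (n + 1)) ^ 24 : PowerSeries ℚ) =
      (∏ n ∈ Finset.range M, (1 - PowerSeries.X ^ (n + 1)) ^ 24) *
        (-24 * ∑ n ∈ Finset.range M, lambertTerm (n + 1)) := by
  induction M with
  | zero => simp [eulerOp_one]
  | succ M ih =>
    rw [Finset.prod_range_succ, Finset.sum_range_succ, eulerOp_mul, ih,
      eulerOp_pow_succ _ 23, eulerOp_one_sub_X_pow (Nat.add_one_ne_zero M)]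
    generalize (1 - PowerSeries.X ^ (M + 1) : PowerSeries ℚ) = y
    generalize (∏ n ∈ Finset.range M, (1 - PowerSeries.X ^ (n + 1)) ^ 24 : PowerSeries ℚ) = p
    push_cast
    ring

lemma coeff_sum_lambertTerm {m M : ℕ} (h : m ≤ M) :
    (-24 * ∑ n ∈ Finset.range M, lambertTerm (n + 1)).coeff m = (E2series ℚ - 1).coeff m := by
  have h24 : (-24 : PowerSeries ℚ) = PowerSeries.C (-24) := by rw [map_neg, map_ofNat]
  rw [h24, PowerSeries.coeff_C_mul, map_sum, map_sub, PowerSeries.coeff_one]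
  rcases eq_or_ne m 0 with rfl | hm
  · simp [lambertTerm, E2series]
  · simp only [lambertTerm, E2series, PowerSeries.coeff_mk, hm, ne_eq, not_false_eq_true,
      and_true, if_false, sub_zero, ArithmeticFunction.sigma_apply, pow_one]
    congr 1
    rw [← Finset.sum_filter, Nat.cast_sum]
    refine Finset.sum_bij (fun n _ ↦ n + 1) ?_ ?_ ?_ ?_
    · intro n hn
      simp_all
    · intro a _ b _ hab
      simpa using hab
    · intro b hb
      have h1 := Nat.pos_of_mem_divisors hb
      have h2 := Nat.divisor_le hb
      refine ⟨b - 1, ?_, by omega⟩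
      rw [Finset.mem_filter, Finset.mem_range, Nat.sub_add_cancel h1]
      exact ⟨by omega, Nat.dvd_of_mem_divisors hb⟩
    · intros
      rfl

/-- The power series `∏_{n ≥ 1} (1 - q^n)^24`. -/
def etaProd : PowerSeries ℚ :=
  .mk fun N ↦ PowerSeries.coeff N (∏ n ∈ Finset.range N, (1 - PowerSeries.X ^ (n + 1)) ^ 24)

lemma coeff_prod_range {N M : ℕ} (h : N ≤ M) :
    PowerSeries.coeff (R := ℚ) N (∏ n ∈ Finset.range M, (1 - PowerSeries.X ^ (n + 1)) ^ 24) =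
      etaProd.coeff N := by
  induction M, h using Nat.le_induction with
  | base => simp [etaProd]
  | succ M h ih =>
    rw [← ih, Finset.prod_range_succ, ← sub_eq_zero, ← map_sub]
    have h1 := sub_dvd_pow_sub_pow (1 - PowerSeries.X ^ (M + 1) : PowerSeries ℚ) 1 24
    rw [one_pow, sub_sub_cancel_left, neg_dvd] at h1
    have h2 := h1.mul_left (∏ n ∈ Finset.range M, (1 - PowerSeries.X ^ (n + 1)) ^ 24)
    rw [mul_sub, mul_one] at h2
    exact PowerSeries.X_pow_dvd_iff.mp h2 N (by omega)

lemma Delta_eq : Delta = PowerSeries.X * etaProd := by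
  ext N
  rw [Delta, PowerSeries.coeff_mk]
  rcases N with _ | N
  · simp
  · rw [PowerSeries.coeff_succ_X_mul, PowerSeries.coeff_succ_X_mul, coeff_prod_range (by omega)]

lemma eulerOp_etaProd : eulerOp etaProd = etaProd * (E2series ℚ - 1) := by
  ext N
  rw [coeff_eulerOp, ← coeff_prod_range le_rfl, ← coeff_eulerOp, eulerOp_prod_one_sub_X_pow,
    PowerSeries.coeff_mul, PowerSeries.coeff_mul]
  refine Finset.sum_congr rfl fun p hp ↦ ?_
  have := Finset.HasAntidiagonal.mem_antidiagonal.mp hp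
  rw [coeff_prod_range (by omega), coeff_sum_lambertTerm (by omega)]

lemma constantCoeff_etaProd : etaProd.constantCoeff = 1 := by
  simp [etaProd, ← PowerSeries.coeff_zero_eq_constantCoeff_apply]

lemma etaProd_mul_inv : etaProd * etaProd⁻¹ = 1 :=
  PowerSeries.mul_inv_cancel _ (by simp [constantCoeff_etaProd])

lemma eulerOp_etaProd_inv : eulerOp etaProd⁻¹ = etaProd⁻¹ * (1 - E2series ℚ) := by
  have h := congrArg eulerOp etaProd_mul_inv
  rw [eulerOp_mul, eulerOp_one, eulerOp_etaProd] at h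
  linear_combination etaProd⁻¹ * h -
    (eulerOp etaProd⁻¹ + etaProd⁻¹ * (E2series ℚ - 1)) * etaProd_mul_inv

lemma eulerOp_etaProd_inv_pow (r : ℕ) :
    eulerOp (etaProd⁻¹ ^ r) = r * (etaProd⁻¹ ^ r * (1 - E2series ℚ)) := by
  rcases r with _ | r
  · simp [eulerOp_one]
  · rw [eulerOp_pow_succ, eulerOp_etaProd_inv]
    push_cast
    ring

lemma constantCoeff_etaProd_inv_pow (r : ℕ) : (etaProd⁻¹ ^ r).constantCoeff = 1 := by
  simp [constantCoeff_etaProd]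

lemma coeff_one_sub_E2series_pos {m : ℕ} (hm : m ≠ 0) : 0 < (1 - E2series ℚ).coeff m := by
  simpa [E2series, PowerSeries.coeff_one, hm] using Nat.pos_of_ne_zero hm

lemma coeff_mul_pos {F Q : PowerSeries ℚ} {m n : ℕ} (hmn : m ≤ n) (hF : ∀ i, 0 ≤ F.coeff i)
    (hm : 0 < F.coeff m) (hQ : ∀ i, 0 < Q.coeff i) : 0 < (F * Q).coeff n := by
  rw [PowerSeries.coeff_mul]
  refine Finset.sum_pos' (fun p hp ↦ ?_) ⟨(m, n - m), by simp [hmn], mul_pos hm (hQ _)⟩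
  exact mul_nonneg (hF _) (hQ _).le

lemma coeff_etaProd_inv_pow_pos {r : ℕ} (hr : r ≠ 0) (n : ℕ) : 0 < (etaProd⁻¹ ^ r).coeff n := by
  induction n using Nat.strong_induction_on with
  | _ n ih =>
  rcases eq_or_ne n 0 with rfl | hn
  · simp [constantCoeff_etaProd_inv_pow]
  · have h := congrArg (PowerSeries.coeff n) (eulerOp_etaProd_inv_pow r)
    rw [coeff_eulerOp, ← map_natCast (PowerSeries.C (R := ℚ)), PowerSeries.coeff_C_mul,
      PowerSeries.coeff_mul] at h
    have hsum : 0 < ∑ p ∈ Finset.HasAntidiagonal.antidiagonal n,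
        (etaProd⁻¹ ^ r).coeff p.1 * (1 - E2series ℚ).coeff p.2 := by
      refine Finset.sum_pos' (fun p hp ↦ ?_) ⟨(0, n), by simp, ?_⟩
      · have hp' := Finset.HasAntidiagonal.mem_antidiagonal.mp hp
        rcases eq_or_ne p.2 0 with h0 | h0
        · simp [h0, E2series]
        · exact mul_nonneg (ih _ (by omega)).le (coeff_one_sub_E2series_pos h0).le
      · exact mul_pos (ih 0 (by omega)) (coeff_one_sub_E2series_pos hn)
    have hr' : (0 : ℚ) < r := by positivity
    have hn' : (0 : ℚ) < n := by positivity
    exact pos_of_mul_pos_right (h ▸ mul_pos hr' hsum) hn'.le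

lemma Gser_zero : Gser 0 = 1 := by
  ext n
  simp [Gser, PowerSeries.coeff_one]

lemma Gser_coeff_pos {k : ℕ} (hk : k ≠ 0) (hB : bernoulli k < 0) (n : ℕ) :
    0 < (Gser k).coeff n := by
  rw [Gser, PowerSeries.coeff_mk]
  split_ifs with hn
  · exact one_pos
  · refine mul_pos ?_ ?_
    · rw [neg_pos]
      exact div_neg_of_pos_of_neg (by positivity) hB
    · exact Finset.sum_pos (fun d hd ↦ by have := Nat.pos_of_mem_divisors hd; positivity)
        (Nat.nonempty_divisors.mpr hn)

lemma coeff_mul_eulerOp_identity (g Q : PowerSeries ℚ) (r n : ℕ)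
    (hQ : eulerOp Q = r * (Q * (1 - E2series ℚ))) :
    (r : ℚ) * (g ^ n * (g * E2series ℚ - (3 : ℚ) • eulerOp g) * Q).coeff r =
      (n + 1 - 3 * r) * (g ^ n * eulerOp g * Q).coeff r := by
  have h := coeff_eulerOp (g ^ (n + 1) * Q) r
  have hexp : eulerOp (g ^ (n + 1) * Q) =
      PowerSeries.C (n + 1 : ℚ) * (g ^ n * eulerOp g * Q) +
        PowerSeries.C (r : ℚ) * (g ^ (n + 1) * Q) -
        PowerSeries.C (r : ℚ) * (g ^ (n + 1) * E2series ℚ * Q) := by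
    rw [eulerOp_mul, eulerOp_pow_succ, hQ]
    simp only [map_add, map_natCast, map_one]
    ring
  have hc : g ^ n * (g * E2series ℚ - (3 : ℚ) • eulerOp g) * Q =
      g ^ (n + 1) * E2series ℚ * Q - PowerSeries.C (3 : ℚ) * (g ^ n * eulerOp g * Q) := by
    rw [PowerSeries.smul_eq_C_mul]
    ring
  rw [hexp] at h
  rw [hc]
  rw [map_sub, map_add] at h
  rw [map_sub]
  simp only [PowerSeries.coeff_C_mul] at h ⊢
  linear_combination -h

lemma coeff_mul_nonneg {F G : PowerSeries ℚ} (hF : ∀ i, 0 ≤ F.coeff i) (hG : ∀ i, 0 ≤ G.coeff i)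
    (n : ℕ) : 0 ≤ (F * G).coeff n := by
  rw [PowerSeries.coeff_mul]
  exact Finset.sum_nonneg fun p _ ↦ mul_nonneg (hF _) (hG _)

lemma coeff_pow_mul_Gser_six_ne_zero {r n : ℕ} (hr : r ≠ 0) (hn : n + 1 ≠ 3 * r) :
    (Gser 4 ^ n * Gser 6 * etaProd⁻¹ ^ r).coeff r ≠ 0 := by
  have h4 : bernoulli 4 < 0 := by
    rw [show bernoulli 4 = -1 / 30 by decide +kernel]
    norm_num
  have hg := Gser_coeff_pos four_ne_zero h4
  have hpow (n : ℕ) : ∀ i, 0 ≤ (Gser 4 ^ n).coeff i := by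
    induction n with
    | zero =>
      intro i
      rw [pow_zero, PowerSeries.coeff_one]
      split_ifs <;> norm_num
    | succ n ih =>
      rw [pow_succ]
      exact coeff_mul_nonneg ih fun i ↦ (hg i).le
  have hθ (i : ℕ) : 0 ≤ (eulerOp (Gser 4)).coeff i := by
    rw [coeff_eulerOp]
    exact mul_nonneg i.cast_nonneg (hg i).le
  have hF : 0 < (Gser 4 ^ n * eulerOp (Gser 4)).coeff 1 := by
    rw [PowerSeries.coeff_mul, Finset.Nat.antidiagonal_succ]
    simp [constantCoeff_Gser, coeff_eulerOp, hg]
  have hA := coeff_mul_pos (Nat.one_le_iff_ne_zero.mpr hr) (coeff_mul_nonneg (hpow n) hθ) hF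
    (coeff_etaProd_inv_pow_pos hr)
  have h := coeff_mul_eulerOp_identity (Gser 4) _ r n (eulerOp_etaProd_inv_pow r)
  rw [← Gser_six] at h
  have hn' : (n + 1 - 3 * r : ℚ) ≠ 0 := sub_ne_zero.mpr (by exact_mod_cast hn)
  exact right_ne_zero_of_mul (h ▸ mul_ne_zero hn' hA.ne')

lemma Tq_eq (h : ℕ) : Tq h = HahnSeries.single (-(rS h : ℤ)) 1 *
    HahnSeries.ofPowerSeries ℤ ℚ (Gser (12 * rS h + 2 - h) * etaProd⁻¹ ^ rS h) := by
  have hΔ : (HahnSeries.ofPowerSeries ℤ ℚ Delta ^ rS h)⁻¹ =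
      HahnSeries.single (-(rS h : ℤ)) 1 * HahnSeries.ofPowerSeries ℤ ℚ (etaProd⁻¹ ^ rS h) := by
    apply inv_eq_of_mul_eq_one_right
    rw [← map_pow, Delta_eq, mul_pow, map_mul, HahnSeries.ofPowerSeries_X_pow, mul_mul_mul_comm,
      HahnSeries.single_mul_single, ← map_mul, ← mul_pow, etaProd_mul_inv]
    simp
  rw [Tq, zpow_neg, zpow_natCast, hΔ, map_mul]
  ring

lemma Tq_coeff (h : ℕ) (n : ℕ) : (Tq h).coeff ((n : ℤ) - rS h) =
    (Gser (12 * rS h + 2 - h) * etaProd⁻¹ ^ rS h).coeff n := by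
  rw [Tq_eq, sub_eq_add_neg, HahnSeries.coeff_single_mul_add, one_mul,
    HahnSeries.ofPowerSeries_apply_coeff]

lemma Tq_coeff_of_lt {h : ℕ} {i : ℤ} (hi : i < -(rS h : ℤ)) : (Tq h).coeff i = 0 := by
  rw [Tq_eq, ← sub_add_cancel i (-(rS h : ℤ)), HahnSeries.coeff_single_mul_add, one_mul,
    PowerSeries.coeff_coe, if_pos (by omega)]

lemma coeff_Gser_mul_ne_zero {h : ℕ} (h4 : 4 ≤ h) (heven : Even h) :
    (Gser (12 * rS h + 2 - h) * etaProd⁻¹ ^ rS h).coeff (rS h) ≠ 0 := by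
  have hr : rS h ≠ 0 := by
    unfold rS
    split_ifs <;> omega
  have hQ := coeff_etaProd_inv_pow_pos hr
  have hneg {k : ℕ} (hk : k ≠ 0) (hB : bernoulli k < 0) :
      (Gser k * etaProd⁻¹ ^ rS h).coeff (rS h) ≠ 0 :=
    (coeff_mul_pos (Nat.zero_le _) (fun i ↦ (Gser_coeff_pos hk hB i).le) (Gser_coeff_pos hk hB 0)
      hQ).ne'
  have hcases : 12 * rS h + 2 - h = 0 ∨ 12 * rS h + 2 - h = 4 ∨ 12 * rS h + 2 - h = 6 ∨
      12 * rS h + 2 - h = 8 ∨ 12 * rS h + 2 - h = 10 ∨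
      12 * rS h + 2 - h = 14 ∧ rS h ≠ 1 := by
    obtain ⟨m, rfl⟩ := heven
    unfold rS
    split_ifs <;> omega
  rcases hcases with hk | hk | hk | hk | hk | ⟨hk, hr1⟩ <;> rw [hk]
  · rw [Gser_zero, one_mul]
    exact (hQ _).ne'
  · refine hneg four_ne_zero ?_
    rw [show bernoulli 4 = -1 / 30 by decide +kernel]
    norm_num
  · have := coeff_pow_mul_Gser_six_ne_zero (n := 0) hr (by omega)
    rwa [pow_zero, one_mul] at this
  · refine hneg (by norm_num) ?_
    rw [show bernoulli 8 = -1 / 30 by decide +kernel]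
    norm_num
  · have := coeff_pow_mul_Gser_six_ne_zero (n := 1) hr (by omega)
    rwa [pow_one, ← Gser_ten] at this
  · have := coeff_pow_mul_Gser_six_ne_zero (n := 2) hr (by omega)
    rwa [← Gser_fourteen] at this

end

theorem Tq_order_and_constant_term (h : ℕ) (h4 : 4 ≤ h) (heven : Even h) :
    cCoeff h (rS h) = 1 ∧
    (∀ i : ℤ, i < -(rS h : ℤ) → (Tq h).coeff i = 0) ∧
    cCoeff h 0 ≠ 0 := by
  refine ⟨?_, fun i hi ↦ Tq_coeff_of_lt hi, ?_⟩
  · have := Tq_coeff h 0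
    rw [Nat.cast_zero, zero_sub] at this
    rw [cCoeff, this]
    simp [constantCoeff_Gser, constantCoeff_etaProd]
  · have := Tq_coeff h (rS h)
    rw [sub_self] at this
    rw [cCoeff, Nat.cast_zero, neg_zero, this]
    exact coeff_Gser_mul_ne_zero h4 heven
end
end

section
/- Let N ≥ 1 be an integer, let F be an intermediate field of the cyclotomic extension ℚ(ζ_N)/ℚ, and let H be the subgroup of (ℤ/Nℤ)ˣ corresponding to Gal(ℚ(ζ_N)/F) under the canonical isomorphism Gal(ℚ(ζ_N)/ℚ) ≅ (ℤ/Nℤ)ˣ. Then for every complex number s ≠ 1, ζ_F(s) = ∏_χ L(χ⁰, s), where the product is over all Dirichlet characters χ modulo N that are trivial on H, χ⁰ denotes the primitive Dirichlet character inducing χ, and L(χ⁰, ·) is the associated Dirichlet L-function (analytically continued); in particular, taking s = 1 − 2k for an integer k ≥ 1, ζ_F(1 − 2k) = ∏_χ (−B_{2k,χ⁰}/(2k)), where B_{2k,χ⁰} is the generalized Bernoulli number attached to χ⁰. -/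
open scoped Classical
noncomputable section

/-- `Z` is the Dedekind zeta function of `F`: it is holomorphic away from `1` and agrees with
the Dirichlet series `∑ N(𝔞)^{-s}` over nonzero integral ideals on the half-plane `Re s > 1`. -/
def IsDedekindZeta (F : Type*) [Field F] (Z : ℂ → ℂ) : Prop :=
  (∀ s : ℂ, s ≠ 1 → DifferentiableAt ℂ Z s) ∧
  ∀ s : ℂ, 1 < s.re → Z s =
    ∑' I : {I : Ideal (NumberField.RingOfIntegers F) // I ≠ ⊥},
      (Nat.card (NumberField.RingOfIntegers F ⧸ (I : Ideal (NumberField.RingOfIntegers F))) : ℂ)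
        ^ (-s)

/-- The generalized Bernoulli number `B_{n,ψ} = f^{n−1}·∑_{a=0}^{f−1} ψ(a)·B_n(a/f)` for a
Dirichlet character `ψ` of modulus `f`, where `B_n` is the `n`-th Bernoulli polynomial. -/
def genBernoulli {N : ℕ} (ψ : DirichletCharacter ℂ N) (n : ℕ) : ℂ :=
  (N : ℂ) ^ (n - 1) *
    ∑ a ∈ Finset.range N,
      ψ (a : ZMod N) * (((Polynomial.bernoulli n).eval ((a : ℚ) / (N : ℚ)) : ℚ) : ℂ)

/-- The Dirichlet L-function of the primitive character `χ⁰` inducing `χ`. -/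
def primLFunction {N : ℕ} [NeZero N] (χ : DirichletCharacter ℂ N) (s : ℂ) : ℂ :=
  letI : NeZero χ.conductor := ⟨DirichletCharacter.conductor_ne_zero χ⟩
  DirichletCharacter.LFunction χ.primitiveCharacter s

open Filter Topology NumberField

namespace Ideal

variable {R : Type*} [CommRing R] [IsDedekindDomain R]

/-- Removing the ideals divisible by a finite set `S` of primes from a completely multiplicative
sum over ideals multiplies it by the inverse Euler factors at the primes in `S`. -/
theorem tsum_coprime_eq_prod_mul_tsum {f : Ideal R → ℂ} (hmul : ∀ I J, f (I * J) = f I * f J)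
    (hsum : Summable f) (S : Finset (Ideal R)) (hS : ∀ P ∈ S, P.IsPrime ∧ P ≠ ⊥) :
    ∑' I, (if ∀ P ∈ S, ¬ P ∣ I then f I else 0) = (∏ P ∈ S, (1 - f P)) * ∑' I, f I := by
  induction S using Finset.induction_on with
  | empty => simp
  | insert P S hPS ih =>
    have hP := hS P (Finset.mem_insert_self P S)
    have hPprime : Prime P := (Ideal.prime_iff_isPrime hP.2).2 hP.1
    have hinj : Function.Injective (fun I : Ideal R ↦ P * I) := mul_right_injective₀ hP.2
    have hsum' (c : Ideal R → Prop) [DecidablePred c] :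
        Summable (fun I ↦ if c I then f I else 0) :=
      (hsum.indicator {I | c I}).congr fun I ↦ by simp [Set.indicator_apply]
    have hsplit (I : Ideal R) : (if ∀ Q ∈ insert P S, ¬ Q ∣ I then f I else 0) =
        (if ∀ Q ∈ S, ¬ Q ∣ I then f I else 0) -
          (if (∀ Q ∈ S, ¬ Q ∣ I) ∧ P ∣ I then f I else 0) := by
      simp only [Finset.forall_mem_insert]
      by_cases h : P ∣ I <;> by_cases h' : ∀ Q ∈ S, ¬ Q ∣ I <;> simp [h, h']
    have hdvd : ∑' I, (if (∀ Q ∈ S, ¬ Q ∣ I) ∧ P ∣ I then f I else 0) =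
        f P * ∑' I, (if ∀ Q ∈ S, ¬ Q ∣ I then f I else 0) := by
      rw [← tsum_mul_left, ← hinj.tsum_eq]
      · refine tsum_congr fun I ↦ ?_
        have : (∀ Q ∈ S, ¬ Q ∣ P * I) ↔ ∀ Q ∈ S, ¬ Q ∣ I := by
          refine forall₂_congr fun Q hQ ↦ not_congr ?_
          have hQ' := hS Q (Finset.mem_insert_of_mem hQ)
          have hQprime : Prime Q := (Ideal.prime_iff_isPrime hQ'.2).2 hQ'.1
          rw [hQprime.dvd_mul, or_iff_right]
          intro h
          exact hPS (associated_iff_eq.1 (hQprime.associated_of_dvd hPprime h) ▸ hQ)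
        simp [this, hmul]
      · intro I hI
        simp only [Function.mem_support, ne_eq, ite_eq_right_iff, Classical.not_imp] at hI
        obtain ⟨J, rfl⟩ := hI.1.2
        exact ⟨J, rfl⟩
    rw [tsum_congr hsplit, (hsum' _).tsum_sub (hsum' _), hdvd,
      ih fun Q hQ ↦ hS Q (Finset.mem_insert_of_mem hQ), Finset.prod_insert hPS]
    ring

/-- The Euler product of a completely multiplicative sum over ideals, along any sequence of finite
sets of primes which eventually contain each prime. -/
theorem tendsto_prod_one_sub_mul_tsum {f : Ideal R → ℂ} (hmul : ∀ I J, f (I * J) = f I * f J)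
    (hbot : f ⊥ = 0) (htop : f ⊤ = 1) (hsum : Summable f) (S : ℕ → Finset (Ideal R))
    (hS : ∀ n, ∀ P ∈ S n, P.IsPrime ∧ P ≠ ⊥)
    (hSev : ∀ P : Ideal R, P.IsPrime → P ≠ ⊥ → ∀ᶠ n in atTop, P ∈ S n) :
    Tendsto (fun n ↦ (∏ P ∈ S n, (1 - f P)) * ∑' I, f I) atTop (𝓝 1) := by
  have hlim : ∑' I, (if I = (⊤ : Ideal R) then f I else 0) = 1 := by
    rw [tsum_ite_eq, htop]
  simp_rw [← tsum_coprime_eq_prod_mul_tsum hmul hsum _ (hS _)]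
  rw [← hlim]
  refine tendsto_tsum_of_dominated_convergence hsum.norm (fun I ↦ ?_)
    (Eventually.of_forall fun n I ↦ by split_ifs <;> simp)
  by_cases hI : I = ⊤
  · refine tendsto_const_nhds.congr fun n ↦ ?_
    rw [if_pos hI, if_pos]
    intro P hP hdvd
    refine (hS n P hP).1.ne_top ?_
    rw [hI, ← Ideal.one_eq_top] at hdvd
    exact Ideal.one_eq_top (R := R) ▸ isUnit_iff_eq_one.1 (isUnit_of_dvd_one hdvd)
  · rw [if_neg hI]
    by_cases hI0 : I = ⊥
    · subst hI0
      simp [hbot]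
    obtain ⟨M, hM, hIM⟩ := Ideal.exists_le_maximal I hI
    have hM0 : M ≠ ⊥ := fun h ↦ hI0 (le_bot_iff.1 (h ▸ hIM))
    refine tendsto_const_nhds.congr' ?_
    filter_upwards [hSev M hM.isPrime hM0] with n hn
    rw [if_neg]
    exact fun h ↦ h M hn (Ideal.dvd_iff_le.2 hIM)

end Ideal

namespace NumberField

variable (F : Type*) [Field F] [NumberField F]

theorem LSeriesSummable_card_ideal_absNorm_eq {s : ℂ} (hs : 1 < s.re) :
    LSeriesSummable
      (fun n ↦ ((Nat.card {I : Ideal (𝓞 F) // Ideal.absNorm I = n} : ℝ) : ℂ)) s := by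
  refine LSeriesSummable_of_sum_norm_bigO_and_nonneg (r := 1) ?_ (fun _ ↦ by positivity)
    zero_le_one hs
  have h := ((Ideal.tendsto_norm_le_div_atTop₀ F).comp tendsto_natCast_atTop_atTop).isBigO_one ℝ
  have h' := h.mul (Asymptotics.isBigO_refl (fun n : ℕ ↦ (n : ℝ)) atTop)
  refine h'.congr' ?_ (by simp)
  filter_upwards [eventually_ne_atTop 0] with n hn
  have hn' : (n : ℝ) ≠ 0 := by exact_mod_cast hn
  simp only [Function.comp_apply, Nat.cast_le, ← Nat.cast_sum]
  rw [div_mul_cancel₀ _ hn', Nat.cast_inj]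
  rw [← add_left_inj 1, ← Ideal.card_norm_le_eq_card_norm_le_add_one,
    show Finset.Icc 1 n = Finset.Ioc 0 n from Finset.Icc_succ_left_eq_Ioc _ _,
    show 1 = Nat.card {I : Ideal (𝓞 F) // Ideal.absNorm I = 0} by simp [Ideal.absNorm_eq_zero_iff],
    Finset.sum_Ioc_add_eq_sum_Icc (n.zero_le),
    ← Finset.card_preimage_eq_sum_card_image_eq
      (fun k _ ↦ Ideal.finite_setOfPred_absNorm_eq k)]
  simp [Set.coe_eq_subtype]

theorem summable_absNorm_cpow {s : ℂ} (hs : 1 < s.re) :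
    Summable (fun I : Ideal (𝓞 F) ↦ (Ideal.absNorm I : ℂ) ^ (-s)) := by
  rw [← summable_norm_iff, ← (Equiv.sigmaFiberEquiv (Ideal.absNorm (S := 𝓞 F))).summable_iff,
    Function.comp_def,
    summable_sigma_of_nonneg fun _ ↦ by exact norm_nonneg _]
  have hfin (n : ℕ) : Finite {I : Ideal (𝓞 F) // Ideal.absNorm I = n} :=
    (Ideal.finite_setOfPred_absNorm_eq n).to_subtype
  refine ⟨fun n ↦ Summable.of_finite, ?_⟩
  refine (LSeriesSummable_card_ideal_absNorm_eq F hs).norm.congr fun n ↦ ?_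
  have hval (I : {I : Ideal (𝓞 F) // Ideal.absNorm I = n}) :
      ‖(Ideal.absNorm (Equiv.sigmaFiberEquiv (Ideal.absNorm (S := 𝓞 F)) ⟨n, I⟩) : ℂ) ^ (-s)‖ =
        ‖(n : ℂ) ^ (-s)‖ := by
    simp [I.2]
  have hs0 : -s ≠ 0 := fun h ↦ by
    rw [neg_eq_zero.1 h, Complex.zero_re] at hs
    linarith
  refine Eq.trans ?_ (tsum_congr hval).symm
  rw [tsum_const, nsmul_eq_mul]
  rcases eq_or_ne n 0 with rfl | hn
  · simp [Complex.zero_cpow hs0]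
  · rw [LSeries.term_of_ne_zero hn, norm_div, Complex.cpow_neg, norm_inv, div_eq_mul_inv]
    simp

end NumberField

namespace CommGroup

variable {A : Type*} [CommGroup A] [Finite A]

/-- The values at `a` of the complex characters of `A` are all the roots of unity of order dividing
`orderOf a`. -/
theorem range_eval_monoidHom_eq_rootsOfUnity (a : A) :
    (MonoidHom.eval a : (A →* ℂˣ) →* ℂˣ).range = rootsOfUnity (orderOf a) ℂ := by
  have : NeZero (orderOf a) := ⟨(orderOf_pos a).ne'⟩
  have hle : (MonoidHom.eval a : (A →* ℂˣ) →* ℂˣ).range ≤ rootsOfUnity (orderOf a) ℂ := by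
    rintro _ ⟨χ, rfl⟩
    rw [mem_rootsOfUnity, MonoidHom.eval_apply_apply, ← map_pow, pow_orderOf_eq_one, map_one]
  have : Finite (MonoidHom.eval a : (A →* ℂˣ) →* ℂˣ).range :=
    Finite.of_injective _ (Subgroup.inclusion_injective hle)
  refine Subgroup.eq_of_le_of_card_ge hle ?_
  rw [Complex.card_rootsOfUnity]
  refine Nat.le_of_dvd Nat.card_pos (orderOf_dvd_of_pow_eq_one ?_)
  by_contra h
  obtain ⟨χ, hχ⟩ := exists_apply_ne_one_of_hasEnoughRootsOfUnity A ℂ h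
  refine hχ ?_
  have hmem : χ a ∈ (MonoidHom.eval a : (A →* ℂˣ) →* ℂˣ).range := ⟨χ, rfl⟩
  rw [map_pow]
  exact congrArg Subtype.val (pow_card_eq_one' (x := (⟨χ a, hmem⟩ : MonoidHom.range _)))

/-- The product of `1 - χ(a) T` over all complex characters `χ` of a finite abelian group. -/
theorem prod_monoidHom_one_sub_mul [Fintype (A →* ℂˣ)] (a : A) {r : ℕ}
    (hr : Nat.card A = r * orderOf a) (T : ℂ) :
    ∏ χ : A →* ℂˣ, (1 - (χ a : ℂ) * T) = (1 - T ^ orderOf a) ^ r := by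
  have hpos : 0 < orderOf a := orderOf_pos a
  have : NeZero (orderOf a) := ⟨hpos.ne'⟩
  have : Finite (rootsOfUnity (orderOf a) ℂ : Set ℂˣ) :=
    inferInstanceAs (Finite (rootsOfUnity (orderOf a) ℂ))
  have := Fintype.ofFinite (rootsOfUnity (orderOf a) ℂ : Set ℂˣ)
  set ev : (A →* ℂˣ) →* ℂˣ := MonoidHom.eval a with hev
  have hrange := range_eval_monoidHom_eq_rootsOfUnity a
  rw [← hev] at hrange
  have hmaps : ∀ χ ∈ (Finset.univ : Finset (A →* ℂˣ)),
      ev χ ∈ (rootsOfUnity (orderOf a) ℂ : Set ℂˣ).toFinset := fun χ _ ↦ by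
    rw [Set.mem_toFinset, ← hrange]
    exact ⟨χ, rfl⟩
  have hfib : ∀ z ∈ (rootsOfUnity (orderOf a) ℂ : Set ℂˣ).toFinset,
      (Finset.univ.filter fun χ ↦ ev χ = z).card = (Finset.univ.filter fun χ ↦ ev χ = 1).card := by
    intro z hz
    rw [Set.mem_toFinset, ← hrange] at hz
    exact MonoidHom.card_fiber_eq_of_mem_range ev hz ⟨1, map_one ev⟩
  have hcardroots : (rootsOfUnity (orderOf a) ℂ : Set ℂˣ).toFinset.card = orderOf a := by
    rw [Set.toFinset_card, Fintype.card_eq_nat_card]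
    exact Complex.card_rootsOfUnity _
  have hcard : (Finset.univ.filter fun χ ↦ ev χ = 1).card = r := by
    have h := Finset.card_eq_sum_card_fiberwise hmaps
    rw [Finset.sum_congr rfl hfib, Finset.sum_const, smul_eq_mul, hcardroots, Finset.card_univ,
      Fintype.card_eq_nat_card, card_monoidHom_of_hasEnoughRootsOfUnity, hr, mul_comm] at h
    exact (Nat.eq_of_mul_eq_mul_left hpos h).symm
  rw [← Finset.prod_fiberwise_of_maps_to hmaps]
  have hinner : ∀ z ∈ (rootsOfUnity (orderOf a) ℂ : Set ℂˣ).toFinset,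
      ∏ χ with ev χ = z, (1 - (χ a : ℂ) * T) = (1 - (z : ℂ) * T) ^ r := by
    intro z hz
    rw [← hcard, ← hfib z hz]
    refine Finset.prod_eq_pow_card fun χ hχ ↦ ?_
    rw [← (Finset.mem_filter.1 hχ).2]
    rfl
  rw [Finset.prod_congr rfl hinner, Finset.prod_pow]
  congr 1
  have h := (Complex.isPrimitiveRoot_exp _ hpos.ne').pow_sub_pow_eq_prod_sub_mul 1 T hpos
  rw [one_pow] at h
  rw [h]
  refine Finset.prod_nbij (fun z ↦ (z : ℂ)) (fun z hz ↦ ?_) Units.val_injective.injOn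
    (fun z hz ↦ ?_) fun _ _ ↦ rfl
  · rw [Set.mem_toFinset, SetLike.mem_coe, mem_rootsOfUnity'] at hz
    exact (Polynomial.mem_nthRootsFinset hpos _).2 hz
  · have hz' := (Polynomial.mem_nthRootsFinset hpos _).1 hz
    have hz0 : z ≠ 0 := by
      rintro rfl
      simp [hpos.ne'] at hz'
    refine ⟨Units.mk0 z hz0, ?_, rfl⟩
    rw [Finset.mem_coe, Set.mem_toFinset, SetLike.mem_coe, mem_rootsOfUnity']
    exact hz'

/-- The product of `1 - χ(a) T` over the complex characters `χ` trivial on a subgroup. -/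
theorem prod_monoidHom_trivialOn_one_sub_mul [Fintype (A →* ℂˣ)] (K : Subgroup A) (a : A) {r : ℕ}
    (hr : K.index = r * orderOf (a : A ⧸ K)) (T : ℂ) :
    ∏ χ : A →* ℂˣ with K ≤ χ.ker, (1 - (χ a : ℂ) * T) = (1 - T ^ orderOf (a : A ⧸ K)) ^ r := by
  have := Fintype.ofFinite ((A ⧸ K) →* ℂˣ)
  rw [← prod_monoidHom_one_sub_mul (a : A ⧸ K) hr]
  symm
  refine Finset.prod_nbij (fun χ ↦ χ.comp (QuotientGroup.mk' K)) (fun χ _ ↦ ?_) ?_ ?_ ?_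
  · refine Finset.mem_filter.2 ⟨Finset.mem_univ _, fun x hx ↦ ?_⟩
    rw [MonoidHom.mem_ker, MonoidHom.comp_apply, QuotientGroup.mk'_apply,
      (QuotientGroup.eq_one_iff x).2 hx, map_one]
  · exact fun χ _ ψ _ h ↦ QuotientGroup.monoidHom_ext K h
  · intro χ hχ
    refine ⟨QuotientGroup.lift K χ (Finset.mem_filter.1 hχ).2, Finset.mem_univ _, ?_⟩
    ext x
    rfl
  · exact fun _ _ ↦ rfl

end CommGroup

namespace DirichletCharacter

variable {N : ℕ} [NeZero N]

theorem conductor_dvd_iff_ker_unitsMap_le {m : ℕ} (hm : m ∣ N) (χ : DirichletCharacter ℂ N) :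
    χ.conductor ∣ m ↔ (ZMod.unitsMap hm).ker ≤ χ.toUnitHom.ker := by
  rw [← χ.mem_conductorSet_iff_conductor_dvd hm, mem_conductorSet_iff,
    factorsThrough_iff_ker_unitsMap hm]

omit [NeZero N] in
/-- The primitive character vanishes at `p` unless it factors through the prime-to-`p` part of the
level. -/
theorem primitiveCharacter_apply_eq_zero {p m k : ℕ} (hN : N = p ^ k * m)
    {χ : DirichletCharacter ℂ N} (h : ¬ χ.conductor ∣ m) : χ.primitiveCharacter p = 0 := by
  refine MulChar.map_nonunit _ fun hu ↦ h ?_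
  rw [ZMod.isUnit_iff_coprime] at hu
  have hdvd : χ.conductor ∣ p ^ k * m := hN ▸ χ.conductor_dvd_level
  exact (Nat.Coprime.pow_right k hu.symm).dvd_of_dvd_mul_left hdvd

omit [NeZero N] in
theorem primitiveCharacter_apply_eq_of_conductor_dvd {m n : ℕ} (hm : m ∣ N)
    {χ : DirichletCharacter ℂ N} (h : χ.conductor ∣ m) {g : (ZMod N)ˣ}
    (hg : ((ZMod.unitsMap hm g : (ZMod m)ˣ) : ZMod m) = n) :
    χ.primitiveCharacter n = χ g := by
  conv_rhs => rw [← χ.changeLevel_primitiveCharacter]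
  rw [changeLevel_eq_cast_of_dvd]
  congr 1
  have h' := congrArg (ZMod.castHom h (ZMod χ.conductor)) hg
  rw [map_natCast] at h'
  rw [← h', ZMod.unitsMap_def, Units.coe_map]
  have hcomp := ZMod.castHom_comp h hm
  exact DFunLike.congr_fun hcomp (g : ZMod N)

/-- The Euler factor at `p` of the product of the primitive `L`-functions attached to the
characters which are trivial on `H`. -/
theorem prod_one_sub_primitiveCharacter_mul [Fintype (DirichletCharacter ℂ N)] {p m k : ℕ}
    (hN : N = p ^ k * m) (hm : m ∣ N) (H : Subgroup (ZMod N)ˣ) (g : (ZMod N)ˣ)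
    (hg : ((ZMod.unitsMap hm g : (ZMod m)ˣ) : ZMod m) = p) {r : ℕ}
    (hr : (H ⊔ (ZMod.unitsMap hm).ker).index =
      r * orderOf (g : (ZMod N)ˣ ⧸ (H ⊔ (ZMod.unitsMap hm).ker))) (T : ℂ) :
    ∏ χ : DirichletCharacter ℂ N with (∀ u ∈ H, χ u = 1), (1 - χ.primitiveCharacter p * T) =
      (1 - T ^ orderOf (g : (ZMod N)ˣ ⧸ (H ⊔ (ZMod.unitsMap hm).ker))) ^ r := by
  have := Fintype.ofFinite ((ZMod N)ˣ →* ℂˣ)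
  have htriv (χ : DirichletCharacter ℂ N) : (∀ u ∈ H, χ u = 1) ↔ H ≤ χ.toUnitHom.ker := by
    refine forall₂_congr fun u _ ↦ ?_
    rw [MonoidHom.mem_ker, Units.ext_iff, MulChar.coe_toUnitHom, Units.val_one]
  rw [← CommGroup.prod_monoidHom_trivialOn_one_sub_mul _ g hr]
  have hfilter : ∏ χ : DirichletCharacter ℂ N with (∀ u ∈ H, χ u = 1),
        (1 - χ.primitiveCharacter p * T) =
      ∏ χ : DirichletCharacter ℂ N with H ⊔ (ZMod.unitsMap hm).ker ≤ χ.toUnitHom.ker,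
        (1 - χ.primitiveCharacter p * T) := by
    symm
    refine Finset.prod_subset (fun χ hχ ↦ ?_) fun χ hχ hχ' ↦ ?_
    · rw [Finset.mem_filter, sup_le_iff] at hχ
      exact Finset.mem_filter.2 ⟨Finset.mem_univ _, (htriv χ).2 hχ.2.1⟩
    · rw [Finset.mem_filter, htriv] at hχ
      rw [Finset.mem_filter, sup_le_iff] at hχ'
      rw [primitiveCharacter_apply_eq_zero hN, zero_mul, sub_zero]
      rw [conductor_dvd_iff_ker_unitsMap_le hm]
      exact fun h ↦ hχ' ⟨Finset.mem_univ _, hχ.2, h⟩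
  rw [hfilter]
  refine Finset.prod_bij (fun χ _ ↦ χ.toUnitHom) (fun χ hχ ↦ ?_)
    (fun χ _ ψ _ h ↦ MulChar.equivToUnitHom.injective h) (fun φ hφ ↦ ?_) fun χ hχ ↦ ?_
  · simpa using hχ
  · refine ⟨MulChar.ofUnitHom φ, ?_, MulChar.equivToUnitHom.apply_symm_apply φ⟩
    have : (MulChar.ofUnitHom φ).toUnitHom = φ := MulChar.equivToUnitHom.apply_symm_apply φ
    rw [Finset.mem_filter, this]
    simpa using hφ
  · rw [Finset.mem_filter, sup_le_iff] at hχ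
    rw [primitiveCharacter_apply_eq_of_conductor_dvd hm
      ((conductor_dvd_iff_ker_unitsMap_le hm χ).2 hχ.2.2) hg, MulChar.coe_toUnitHom]

end DirichletCharacter

/-- In a finite abelian group, let `I ≤ D` with `D` generated by `I` and `φ`. The indices of a
subgroup `H` in `I`, in `D` and in the whole group determine the order of `φ` modulo `H ⊔ I` and
the index of `H ⊔ I`. -/
theorem CommGroup.orderOf_mk_sup_and_index_sup {G : Type*} [CommGroup G] {H I D : Subgroup G}
    {φ : G} {r e f : ℕ} (he : e ≠ 0) (hID : I ≤ D) (hφ : φ ∈ D) (hD : D ≤ I ⊔ Subgroup.zpowers φ)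
    (hHI : H.relIndex I = e) (hHD : H.relIndex D = e * f) (hH : H.index = r * (e * f)) :
    orderOf (φ : G ⧸ (H ⊔ I)) = f ∧ (H ⊔ I).index = r * f := by
  have h₁ : H.relIndex (H ⊔ I) = e := by rw [Subgroup.relIndex_sup_left, hHI]
  have h₂ : H.relIndex (H ⊔ D) = e * f := by rw [Subgroup.relIndex_sup_left, hHD]
  have h₃ : H ⊔ D = (H ⊔ I) ⊔ Subgroup.zpowers φ := by
    refine le_antisymm ?_ (sup_le (sup_le_sup_left hID H) ?_)
    · rw [sup_assoc]
      exact sup_le_sup_left hD H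
    · exact (Subgroup.zpowers_le.2 hφ).trans le_sup_right
  have h₄ : (H ⊔ I).relIndex (H ⊔ D) = orderOf (φ : G ⧸ (H ⊔ I)) := by
    conv_lhs => rw [h₃, Subgroup.relIndex_sup_left, ← QuotientGroup.ker_mk' (H ⊔ I)]
    rw [Subgroup.relIndex_ker, MonoidHom.map_zpowers, Nat.card_zpowers, QuotientGroup.mk'_apply]
  have h₅ := Subgroup.relIndex_mul_relIndex H (H ⊔ I) (H ⊔ D) le_sup_left (sup_le_sup_left hID H)
  have h₆ := Subgroup.relIndex_mul_index (le_sup_left : H ≤ H ⊔ I)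
  rw [h₁, h₂, h₄] at h₅
  rw [h₁, hH] at h₆
  refine ⟨Nat.eq_of_mul_eq_mul_left (Nat.pos_of_ne_zero he) h₅,
    Nat.eq_of_mul_eq_mul_left (Nat.pos_of_ne_zero he) (h₆.trans ?_)⟩
  ring

section RelIndexFixingSubgroup

open scoped Pointwise

namespace Subgroup

theorem card_subgroupOf_mul_relIndex {G : Type*} [Group G] (H L : Subgroup G) :
    Nat.card (L.subgroupOf H) * H.relIndex L = Nat.card L := by
  rw [Nat.card_congr ((L.subgroupOf H).equivMapOfInjective _ H.subtype_injective).toEquiv,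
    subgroupOf_map_subtype, inf_comm, ← relIndex_bot_left, relIndex_inf_mul_relIndex, bot_inf_eq,
    relIndex_bot_left]

end Subgroup

namespace NumberField

variable {K : Type*} [Field K] [NumberField K] [IsGalois ℚ K] (F : IntermediateField ℚ K)
  [IsGalois ℚ F] (𝔭 : Ideal ℤ) [𝔭.IsPrime] (Q : Ideal (𝓞 K)) [Q.IsPrime] [Q.LiesOver 𝔭]

/-- The index of `Gal(K/F)` in the inertia group is the ramification index in `F`. -/
theorem relIndex_fixingSubgroup_inertia :
    F.fixingSubgroup.relIndex (Q.inertia Gal(K/ℚ)) = 𝔭.ramificationIdxIn (𝓞 F) := by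
  have : IsGaloisGroup F.fixingSubgroup F K :=
    IsGaloisGroup.intermediateField Gal(K/ℚ) ℚ K F
  have : IsGaloisGroup F.fixingSubgroup (𝓞 F) (𝓞 K) :=
    IsGaloisGroup.of_isFractionRing F.fixingSubgroup (𝓞 F) (𝓞 K) F K
  have : (Q.under (𝓞 F)).LiesOver 𝔭 := inferInstance
  have h₁ := Ideal.card_inertia_eq_ramificationIdxIn (G := Gal(K/ℚ)) 𝔭 Q
  have h₂ := Ideal.card_inertia_eq_ramificationIdxIn (G := F.fixingSubgroup) (Q.under (𝓞 F)) Q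
  have h₃ := Ideal.ramificationIdxIn_mul_ramificationIdxIn (p := 𝔭) (Q.under (𝓞 F)) Gal(F/ℚ) (𝓞 K)
    Gal(K/ℚ) F.fixingSubgroup
  have h₄ := Subgroup.card_subgroupOf_mul_relIndex F.fixingSubgroup (Q.inertia Gal(K/ℚ))
  have h₅ : (Q.inertia Gal(K/ℚ)).subgroupOf F.fixingSubgroup = Q.inertia F.fixingSubgroup :=
    AddSubgroup.subgroupOf_inertia _ _
  rw [h₅, h₁, h₂, ← h₃, mul_comm] at h₄
  refine Nat.eq_of_mul_eq_mul_right (Nat.pos_of_ne_zero ?_) h₄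
  rw [← h₂]
  exact Nat.card_pos.ne'

/-- The index of `Gal(K/F)` in the decomposition group. -/
theorem relIndex_fixingSubgroup_stabilizer :
    F.fixingSubgroup.relIndex (MulAction.stabilizer Gal(K/ℚ) Q) =
      𝔭.ramificationIdxIn (𝓞 F) * 𝔭.inertiaDegIn (𝓞 F) := by
  have : IsGaloisGroup F.fixingSubgroup F K :=
    IsGaloisGroup.intermediateField Gal(K/ℚ) ℚ K F
  have : IsGaloisGroup F.fixingSubgroup (𝓞 F) (𝓞 K) :=
    IsGaloisGroup.of_isFractionRing F.fixingSubgroup (𝓞 F) (𝓞 K) F K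
  have : (Q.under (𝓞 F)).LiesOver 𝔭 := inferInstance
  have h₁ := Ideal.card_stabilizer_eq (G := Gal(K/ℚ)) 𝔭 Q
  have h₂ := Ideal.card_stabilizer_eq (G := F.fixingSubgroup) (Q.under (𝓞 F)) Q
  have h₃ := Ideal.ramificationIdxIn_mul_ramificationIdxIn (p := 𝔭) (Q.under (𝓞 F)) Gal(F/ℚ) (𝓞 K)
    Gal(K/ℚ) F.fixingSubgroup
  have h₃' := Ideal.inertiaDegIn_mul_inertiaDegIn 𝔭 (Q.under (𝓞 F)) Gal(F/ℚ) (𝓞 K)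
    Gal(K/ℚ) F.fixingSubgroup
  have h₄ := Subgroup.card_subgroupOf_mul_relIndex F.fixingSubgroup (MulAction.stabilizer Gal(K/ℚ) Q)
  have h₅ : (MulAction.stabilizer Gal(K/ℚ) Q).subgroupOf F.fixingSubgroup =
    MulAction.stabilizer F.fixingSubgroup Q := rfl
  rw [h₅, h₁, ← h₃, ← h₃', mul_mul_mul_comm, ← h₂, mul_comm] at h₄
  exact Nat.eq_of_mul_eq_mul_right Nat.card_pos h₄

theorem index_fixingSubgroup_eq_ncard_mul :
    F.fixingSubgroup.index = (𝔭.primesOver (𝓞 F)).ncard *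
      (𝔭.ramificationIdxIn (𝓞 F) * 𝔭.inertiaDegIn (𝓞 F)) := by
  rw [Ideal.ncard_primesOver_mul_ramificationIdxIn_mul_inertiaDegIn 𝔭 (𝓞 F) Gal(F/ℚ),
    IsGaloisGroup.card_eq_finrank Gal(F/ℚ) ℚ F, IntermediateField.finrank_eq_fixingSubgroup_index]

end NumberField

end RelIndexFixingSubgroup

section CyclotomicSplitting

open scoped Pointwise

namespace IsCyclotomicExtension.Rat

variable {N : ℕ} [NeZero N] {K : Type*} [Field K] [NumberField K] [IsCyclotomicExtension {N} ℚ K]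
  {e : Gal(K/ℚ) ≃* (ZMod N)ˣ} (he : ∀ σ : Gal(K/ℚ), ∀ ζ : K, ζ ^ N = 1 →
    σ ζ = ζ ^ (e σ : ZMod N).val)
  {p m k : ℕ} [hp : Fact p.Prime] (hN : N = p ^ k * m) (hpm : ¬ p ∣ m) (hm : m ∣ N)
  (Q : Ideal (𝓞 K)) [Q.IsPrime] [Q.LiesOver (Ideal.span {(p : ℤ)})]

include he hN hpm in
/-- If `σ` acts as the power map `x ↦ x ^ j` modulo a prime above `p`, then the residue class
attached to `σ` is `j` modulo the prime-to-`p` part of `N`. -/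
theorem unitsMap_eq_natCast_of_smul_sub_pow_mem {σ : Gal(K/ℚ)} {j : ℕ}
    (h : ∀ x : 𝓞 K, σ • x - x ^ j ∈ Q) :
    ((ZMod.unitsMap hm (e σ) : (ZMod m)ˣ) : ZMod m) = j := by
  have : NeZero m := ⟨fun h₀ ↦ NeZero.ne N (by rw [hN, h₀, mul_zero])⟩
  have hζ := IsCyclotomicExtension.zeta_spec N ℚ K
  have hξ : IsPrimitiveRoot (hζ.toInteger ^ p ^ k) m :=
    hζ.toInteger_isPrimitiveRoot.pow (NeZero.pos N) hN
  have hσ : σ • hζ.toInteger = hζ.toInteger ^ (e σ : ZMod N).val := by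
    apply FaithfulSMul.algebraMap_injective (𝓞 K) K
    exact he σ _ hζ.pow_eq_one
  have hξQ : IsPrimitiveRoot (Ideal.Quotient.mk Q (hζ.toInteger ^ p ^ k)) m := by
    refine hξ.idealQuotient_mk ?_ ?_
    · simpa using Ideal.IsPrime.ne_top ‹_›
    · rw [← Ideal.pow_inertiaDeg p]
      exact Nat.Coprime.pow_left _ (hp.out.coprime_iff_not_dvd.2 hpm)
  have h₁ := Ideal.Quotient.eq.2 (h (hζ.toInteger ^ p ^ k))
  rw [smul_pow', hσ, pow_right_comm, map_pow, map_pow _ _ j,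
    (hξQ.isOfFinOrder (NeZero.ne m)).pow_inj_mod, ← hξQ.eq_orderOf,
    ← ZMod.natCast_eq_natCast_iff'] at h₁
  rw [← h₁, ZMod.unitsMap_def, Units.coe_map, ZMod.natCast_val]
  rfl

include he hN hpm in
theorem map_inertia_eq_ker_unitsMap :
    (Q.inertia Gal(K/ℚ)).map e.toMonoidHom = (ZMod.unitsMap hm).ker := by
  have : IsGalois ℚ K := IsCyclotomicExtension.isGalois {N} ℚ K
  have hm0 : NeZero m := ⟨fun h₀ ↦ NeZero.ne N (by rw [hN, h₀, mul_zero])⟩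
  refine Subgroup.eq_of_le_of_card_ge ?_ ?_
  · rintro _ ⟨σ, hσ, rfl⟩
    rw [MonoidHom.mem_ker, Units.ext_iff]
    refine (unitsMap_eq_natCast_of_smul_sub_pow_mem he hN hpm hm Q (j := 1) fun x ↦ ?_).trans ?_
    · rw [pow_one]
      exact hσ x
    · simp
  · rw [Subgroup.card_map_of_injective e.injective,
      Ideal.card_inertia_eq_ramificationIdxIn (Ideal.span {(p : ℤ)}) Q]
    have h₁ := Subgroup.card_mul_index (ZMod.unitsMap hm).ker
    rw [Subgroup.index_ker, MonoidHom.range_eq_top.2 (ZMod.unitsMap_surjective hm),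
      Subgroup.card_top, Nat.card_eq_fintype_card (α := (ZMod m)ˣ),
      Nat.card_eq_fintype_card (α := (ZMod N)ˣ), ZMod.card_units_eq_totient,
      ZMod.card_units_eq_totient] at h₁
    have h₂ : N.totient = (p ^ k).totient * m.totient := by
      rw [hN, Nat.totient_mul (Nat.Coprime.pow_left k (hp.out.coprime_iff_not_dvd.2 hpm))]
    rw [h₂] at h₁
    rw [Nat.eq_of_mul_eq_mul_right (Nat.totient_pos.2 (NeZero.pos m)) h₁]
    cases k with
    | zero =>
      have : ¬ p ∣ N := by rwa [hN, pow_zero, one_mul]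
      rw [ramificationIdxIn_eq_of_not_dvd p K this]
      simp
    | succ k =>
      rw [ramificationIdxIn_eq N K hN hpm, Nat.totient_prime_pow_succ hp.out]

include he hN hpm in
theorem exists_unitsMap_eq_pow_of_mem_stabilizer {σ : Gal(K/ℚ)}
    (hσ : σ ∈ MulAction.stabilizer Gal(K/ℚ) Q) :
    ∃ i : ℕ, ((ZMod.unitsMap hm (e σ) : (ZMod m)ˣ) : ZMod m) = (p : ZMod m) ^ i := by
  have hQ0 : Q ≠ ⊥ := Ideal.ne_bot_of_liesOver_of_ne_bot
    (p := Ideal.span {(p : ℤ)}) (by simpa using hp.out.ne_zero) Q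
  have : Q.IsMaximal := Ideal.IsPrime.isMaximal ‹_› hQ0
  have : (Ideal.span {(p : ℤ)}).IsMaximal := Int.ideal_span_isMaximal_of_prime p
  let := Ideal.Quotient.field Q
  let := Ideal.Quotient.field (Ideal.span {(p : ℤ)})
  have : CharP (ℤ ⧸ Ideal.span {(p : ℤ)}) p := ringChar.of_eq <| Int.ringChar_idealQuot p
  have : Finite (𝓞 K ⧸ Q) := Ring.HasFiniteQuotients.finiteQuotient hQ0
  obtain ⟨i, hi⟩ := FiniteField.exists_forall_apply_eq_pow (ℤ ⧸ Ideal.span {(p : ℤ)}) p (𝓞 K ⧸ Q)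
    (Ideal.Quotient.stabilizerHom Q (Ideal.span {(p : ℤ)}) Gal(K/ℚ) ⟨σ, hσ⟩)
  refine ⟨i, ?_⟩
  rw [← Nat.cast_pow]
  refine unitsMap_eq_natCast_of_smul_sub_pow_mem he hN hpm hm Q fun x ↦ ?_
  rw [← Ideal.Quotient.eq, map_pow]
  have := hi (Ideal.Quotient.mk Q x)
  rw [Int.card_ideal_quot] at this
  exact this

include he hN hpm in
theorem exists_mem_stabilizer_unitsMap_eq :
    ∃ φ ∈ MulAction.stabilizer Gal(K/ℚ) Q,
      ((ZMod.unitsMap hm (e φ) : (ZMod m)ˣ) : ZMod m) = p := by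
  have : IsGalois ℚ K := IsCyclotomicExtension.isGalois {N} ℚ K
  have hQ0 : Q ≠ ⊥ := Ideal.ne_bot_of_liesOver_of_ne_bot
    (p := Ideal.span {(p : ℤ)}) (by simpa using hp.out.ne_zero) Q
  have : Finite (𝓞 K ⧸ Q) := Ring.HasFiniteQuotients.finiteQuotient hQ0
  obtain ⟨φ, hφ⟩ := IsArithFrobAt.exists_of_isInvariant ℤ Gal(K/ℚ) Q
  refine ⟨φ, hφ.mem_stabilizer, unitsMap_eq_natCast_of_smul_sub_pow_mem he hN hpm hm Q fun x ↦ ?_⟩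
  have := hφ x
  rw [← Ideal.over_def Q (Ideal.span {(p : ℤ)}), Int.card_ideal_quot] at this
  exact this

include he hN hpm in
/-- The splitting of `p` in a subfield `F` of the `N`-th cyclotomic field: if `H` corresponds to
`F`, the order of `p` modulo `H` and the kernel of reduction to the prime-to-`p` part of `N` is the
inertia degree, and the index of these subgroups gives the number of primes above `p`. -/
theorem exists_orderOf_eq_inertiaDegIn (F : IntermediateField ℚ K) [IsGalois ℚ F] :
    ∃ g : (ZMod N)ˣ, ((ZMod.unitsMap hm g : (ZMod m)ˣ) : ZMod m) = p ∧
      orderOf (g : (ZMod N)ˣ ⧸ (F.fixingSubgroup.map e.toMonoidHom ⊔ (ZMod.unitsMap hm).ker)) =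
        (Ideal.span {(p : ℤ)}).inertiaDegIn (𝓞 F) ∧
      (F.fixingSubgroup.map e.toMonoidHom ⊔ (ZMod.unitsMap hm).ker).index =
        ((Ideal.span {(p : ℤ)}).primesOver (𝓞 F)).ncard *
          (Ideal.span {(p : ℤ)}).inertiaDegIn (𝓞 F) := by
  have : IsGalois ℚ K := IsCyclotomicExtension.isGalois {N} ℚ K
  obtain ⟨⟨Q, _, _⟩⟩ := (Ideal.span {(p : ℤ)}).nonempty_primesOver (S := 𝓞 K)
  have hI := map_inertia_eq_ker_unitsMap he hN hpm hm Q
  obtain ⟨φ, hφ, hφp⟩ := exists_mem_stabilizer_unitsMap_eq he hN hpm hm Q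
  refine ⟨e φ, hφp, ?_⟩
  refine CommGroup.orderOf_mk_sup_and_index_sup (D := (MulAction.stabilizer Gal(K/ℚ) Q).map
    e.toMonoidHom) (e := (Ideal.span {(p : ℤ)}).ramificationIdxIn (𝓞 F))
    (Ideal.ramificationIdxIn_ne_zero Gal(F/ℚ)) ?_ ⟨φ, hφ, rfl⟩ ?_ ?_ ?_ ?_
  · rw [← hI]
    exact Subgroup.map_mono (Ideal.inertia_le_stabilizer Q)
  · rintro _ ⟨σ, hσ, rfl⟩
    obtain ⟨i, hi⟩ := exists_unitsMap_eq_pow_of_mem_stabilizer he hN hpm hm Q hσ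
    rw [← hφp, ← Units.val_pow_eq_pow_val, ← Units.ext_iff, ← map_pow] at hi
    rw [← div_mul_cancel (e.toMonoidHom σ) (e φ ^ i)]
    refine Subgroup.mul_mem_sup ?_ (Subgroup.npow_mem_zpowers _ i)
    rw [MonoidHom.mem_ker, map_div, div_eq_one]
    exact hi
  · rw [← hI, Subgroup.relIndex_map_map_of_injective _ _ e.injective,
      relIndex_fixingSubgroup_inertia F (Ideal.span {(p : ℤ)}) Q]
  · rw [Subgroup.relIndex_map_map_of_injective _ _ e.injective,
      relIndex_fixingSubgroup_stabilizer F (Ideal.span {(p : ℤ)}) Q]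
  · rw [← index_fixingSubgroup_eq_ncard_mul F (Ideal.span {(p : ℤ)})]
    exact Subgroup.index_map_equiv _ e

end IsCyclotomicExtension.Rat

end CyclotomicSplitting

namespace NumberField

variable {F : Type*} [Field F] [NumberField F]

theorem mem_primesOverFinset_span {p : ℕ} (hp : p.Prime) {P : Ideal (𝓞 F)} :
    P ∈ IsDedekindDomain.primesOverFinset (Ideal.span {(p : ℤ)}) (𝓞 F) ↔
      P ∈ (Ideal.span {(p : ℤ)}).primesOver (𝓞 F) := by
  have : Fact p.Prime := ⟨hp⟩
  exact IsDedekindDomain.mem_primesOverFinset_iff (by simpa using hp.ne_zero) (𝓞 F)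

theorem prod_primesOver_one_sub_absNorm_cpow [IsGalois ℚ F] {p : ℕ} (hp : p.Prime) (s : ℂ) :
    ∏ P ∈ IsDedekindDomain.primesOverFinset (Ideal.span {(p : ℤ)}) (𝓞 F),
        (1 - (Ideal.absNorm P : ℂ) ^ (-s)) =
      (1 - ((p : ℂ) ^ (-s)) ^ (Ideal.span {(p : ℤ)}).inertiaDegIn (𝓞 F)) ^
        ((Ideal.span {(p : ℤ)}).primesOver (𝓞 F)).ncard := by
  have : Fact p.Prime := ⟨hp⟩
  rw [← IsDedekindDomain.coe_primesOverFinset (by simpa using hp.ne_zero) (𝓞 F),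
    Set.ncard_coe_finset]
  refine Finset.prod_eq_pow_card fun P hP ↦ ?_
  obtain ⟨_, _⟩ := (mem_primesOverFinset_span hp).1 hP
  rw [← Ideal.pow_inertiaDeg p P, Ideal.inertiaDegIn_eq_inertiaDeg (Ideal.span {(p : ℤ)}) P
    Gal(F/ℚ), Nat.cast_pow, ← Complex.natCast_cpow_natCast_mul, Complex.cpow_nat_mul]

variable (F) in
/-- The nonzero primes of the ring of integers above the rational primes below `n`. -/
def primesAboveBelow (n : ℕ) : Finset (Ideal (𝓞 F)) :=
  n.primesBelow.biUnion fun p ↦ IsDedekindDomain.primesOverFinset (Ideal.span {(p : ℤ)}) (𝓞 F)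

theorem isPrime_and_ne_bot_of_mem_primesAboveBelow {n : ℕ} {P : Ideal (𝓞 F)}
    (hP : P ∈ primesAboveBelow F n) : P.IsPrime ∧ P ≠ ⊥ := by
  obtain ⟨p, hp, hP⟩ := Finset.mem_biUnion.1 hP
  have hp' := Nat.prime_of_mem_primesBelow hp
  obtain ⟨hP₁, hP₂⟩ := (mem_primesOverFinset_span hp').1 hP
  exact ⟨hP₁, Ideal.ne_bot_of_liesOver_of_ne_bot
    (p := Ideal.span {(p : ℤ)}) (by simpa using hp'.ne_zero) P⟩

theorem eventually_mem_primesAboveBelow {P : Ideal (𝓞 F)} (hP : P.IsPrime) (hP0 : P ≠ ⊥) :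
    ∀ᶠ n in atTop, P ∈ primesAboveBelow F n := by
  have : NeZero P := ⟨hP0⟩
  have hp := Nat.absNorm_under_prime P
  filter_upwards [eventually_gt_atTop (Ideal.absNorm (Ideal.under ℤ P))] with n hn
  exact Finset.mem_biUnion.2 ⟨_, Nat.mem_primesBelow.2 ⟨hn, hp⟩,
    (mem_primesOverFinset_span hp).2 ⟨hP, inferInstance⟩⟩

theorem prod_primesAboveBelow (n : ℕ) (f : Ideal (𝓞 F) → ℂ) :
    ∏ P ∈ primesAboveBelow F n, f P =
      ∏ p ∈ n.primesBelow,
        ∏ P ∈ IsDedekindDomain.primesOverFinset (Ideal.span {(p : ℤ)}) (𝓞 F), f P := by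
  refine Finset.prod_biUnion fun p hp q hq hpq ↦ ?_
  rw [Function.onFun, Finset.disjoint_left]
  intro P hP hP'
  rw [mem_primesOverFinset_span (Nat.prime_of_mem_primesBelow hp)] at hP
  rw [mem_primesOverFinset_span (Nat.prime_of_mem_primesBelow hq)] at hP'
  have h := hP.2.over.trans hP'.2.over.symm
  rw [Ideal.span_singleton_eq_span_singleton, Int.associated_iff_natAbs] at h
  exact hpq h

end NumberField

namespace NumberField

/-- If the finite Euler products of a family of primitive `L`-functions agree with those of the
number field `F`, then so do the infinite ones. -/
theorem tsum_absNorm_cpow_eq_prod_primLFunction {F : Type*} [Field F] [NumberField F] {N : ℕ}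
    [NeZero N] (X : Finset (DirichletCharacter ℂ N)) {s : ℂ} (hs : 1 < s.re)
    (hX : ∀ p : ℕ, p.Prime →
      ∏ P ∈ IsDedekindDomain.primesOverFinset (Ideal.span {(p : ℤ)}) (𝓞 F),
        (1 - (Ideal.absNorm P : ℂ) ^ (-s)) =
      ∏ χ ∈ X, (1 - χ.primitiveCharacter p * (p : ℂ) ^ (-s))) :
    ∑' I : Ideal (𝓞 F), (Ideal.absNorm I : ℂ) ^ (-s) = ∏ χ ∈ X, primLFunction χ s := by
  have hs0 : -s ≠ 0 := by
    rw [neg_ne_zero]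
    rintro rfl
    norm_num at hs
  set Z := ∑' I : Ideal (𝓞 F), (Ideal.absNorm I : ℂ) ^ (-s)
  set b : ℕ → ℂ := fun n ↦ ∏ χ ∈ X, ∏ p ∈ n.primesBelow,
    (1 - χ.primitiveCharacter p * (p : ℂ) ^ (-s))⁻¹
  have hb : Tendsto b atTop (𝓝 (∏ χ ∈ X, primLFunction χ s)) := by
    refine tendsto_finsetProd _ fun χ _ ↦ ?_
    have : NeZero χ.conductor := ⟨DirichletCharacter.conductor_ne_zero χ⟩
    rw [primLFunction, DirichletCharacter.LFunction_eq_LSeries _ hs]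
    exact DirichletCharacter.LSeries_eulerProduct χ.primitiveCharacter hs
  have hZ : Tendsto (fun n ↦ (b n)⁻¹ * Z) atTop (𝓝 1) := by
    have h := Ideal.tendsto_prod_one_sub_mul_tsum (f := fun I : Ideal (𝓞 F) ↦
      (Ideal.absNorm I : ℂ) ^ (-s)) (fun I J ↦ ?_) (by simp [hs0]) (by simp)
      (summable_absNorm_cpow F hs) (primesAboveBelow F)
      (fun n P hP ↦ isPrime_and_ne_bot_of_mem_primesAboveBelow hP)
      fun P hP hP0 ↦ eventually_mem_primesAboveBelow hP hP0
    · refine h.congr fun n ↦ ?_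
      congr 1
      rw [prod_primesAboveBelow, Finset.prod_congr rfl fun p hp ↦ hX p
        (Nat.prime_of_mem_primesBelow hp), Finset.prod_comm]
      simp [b]
    · rw [map_mul, Nat.cast_mul, Complex.natCast_mul_natCast_cpow]
  have hZb : Tendsto (fun n ↦ b n * ((b n)⁻¹ * Z)) atTop (𝓝 (∏ χ ∈ X, primLFunction χ s)) := by
    simpa using hb.mul hZ
  refine tendsto_nhds_unique (tendsto_const_nhds.congr' ?_) hZb
  filter_upwards [hZ.eventually_ne one_ne_zero] with n hn
  rw [mul_inv_cancel_left₀ fun h ↦ hn (by rw [h, inv_zero, zero_mul])]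

/-- The Dirichlet series over nonzero ideals, with norms written as cardinalities. -/
theorem tsum_ne_bot_card_quotient_cpow_eq (F : Type*) [Field F] [NumberField F] {s : ℂ}
    (hs : s ≠ 0) :
    ∑' I : {I : Ideal (𝓞 F) // I ≠ ⊥}, (Nat.card (𝓞 F ⧸ (I : Ideal (𝓞 F))) : ℂ) ^ (-s) =
      ∑' I : Ideal (𝓞 F), (Ideal.absNorm I : ℂ) ^ (-s) := by
  refine tsum_subtype_eq_of_support_subset (f := fun I : Ideal (𝓞 F) ↦
    (Ideal.absNorm I : ℂ) ^ (-s)) (s := {I | I ≠ ⊥}) fun I hI h ↦ hI ?_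
  rw [h]
  simp [hs]

end NumberField

theorem eqOn_of_eqOn_one_lt_re {f g : ℂ → ℂ} (hf : ∀ s ≠ 1, DifferentiableAt ℂ f s)
    (hg : ∀ s ≠ 1, DifferentiableAt ℂ g s) (h : ∀ s : ℂ, 1 < s.re → f s = g s) :
    Set.EqOn f g {1}ᶜ := by
  have hopen : IsOpen ({1}ᶜ : Set ℂ) := isOpen_compl_singleton
  have hpre : IsPreconnected ({1}ᶜ : Set ℂ) :=
    (isConnected_compl_singleton_of_one_lt_rank (by simp) 1).isPreconnected
  refine AnalyticOnNhd.eqOn_of_preconnected_of_eventuallyEq (z₀ := 2)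
    (DifferentiableOn.analyticOnNhd (fun s hs ↦ (hf s hs).differentiableWithinAt) hopen)
    (DifferentiableOn.analyticOnNhd (fun s hs ↦ (hg s hs).differentiableWithinAt) hopen)
    hpre (by simp) ?_
  filter_upwards [(isOpen_lt continuous_const Complex.continuous_re).mem_nhds
    (show (1 : ℝ) < (2 : ℂ).re by simp)] with s hs using h s hs

/-- The Euler factors of a subfield of a cyclotomic field. -/
theorem IsCyclotomicExtension.Rat.prod_primesOver_one_sub_eq {N : ℕ} [NeZero N] {K : Type*}
    [Field K] [NumberField K] [IsCyclotomicExtension {N} ℚ K] {e : Gal(K/ℚ) ≃* (ZMod N)ˣ}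
    (he : ∀ σ : Gal(K/ℚ), ∀ ζ : K, ζ ^ N = 1 → σ ζ = ζ ^ (e σ : ZMod N).val)
    (F : IntermediateField ℚ K) [IsGalois ℚ F] [Fintype (DirichletCharacter ℂ N)] (s : ℂ) {p : ℕ}
    (hp : p.Prime) :
    ∏ P ∈ IsDedekindDomain.primesOverFinset (Ideal.span {(p : ℤ)}) (𝓞 F),
        (1 - (Ideal.absNorm P : ℂ) ^ (-s)) =
      ∏ χ : DirichletCharacter ℂ N with
        (∀ u ∈ F.fixingSubgroup.map e.toMonoidHom, χ u = 1),
        (1 - χ.primitiveCharacter p * (p : ℂ) ^ (-s)) := by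
  have : Fact p.Prime := ⟨hp⟩
  obtain ⟨k, m, hpm, hN⟩ := Nat.exists_eq_pow_mul_and_not_dvd (NeZero.ne N) p hp.ne_one
  have hm : m ∣ N := hN ▸ dvd_mul_left m (p ^ k)
  obtain ⟨g, hg, hord, hidx⟩ := exists_orderOf_eq_inertiaDegIn he hN hpm hm F
  rw [prod_primesOver_one_sub_absNorm_cpow hp, ← hord]
  exact (DirichletCharacter.prod_one_sub_primitiveCharacter_mul hN hm _ g hg
    (by rw [hidx, hord]) _).symm

theorem DirichletCharacter.LFunction_neg_natCast {c : ℕ} [NeZero c] (ψ : DirichletCharacter ℂ c)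
    {n : ℕ} (hn : n ≠ 0) :
    ψ.LFunction (-(n : ℂ)) = -(genBernoulli ψ (n + 1)) / (n + 1) := by
  have hc : (0 : ℝ) < c := Nat.cast_pos.mpr (NeZero.pos c)
  have hsum (f : ZMod c → ℂ) : ∑ j, f j = ∑ a ∈ Finset.range c, f (a : ZMod c) := by
    refine Finset.sum_bij' (fun j _ ↦ j.val) (fun a _ ↦ (a : ZMod c)) ?_ ?_ ?_ ?_ ?_
    · simp [ZMod.val_lt]
    · simp
    · simp
    · intro a ha
      exact ZMod.val_cast_of_lt (Finset.mem_range.mp ha)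
    · simp
  rw [DirichletCharacter.LFunction, ZMod.LFunction, hsum, genBernoulli, neg_neg,
    Complex.cpow_natCast, Nat.add_sub_cancel, neg_div, mul_div_assoc, ← mul_neg, ← neg_div,
    ← Finset.sum_neg_distrib, Finset.sum_div]
  congr 1
  refine Finset.sum_congr rfl fun a ha ↦ ?_
  have ha : (a : ℝ) < c := Nat.cast_lt.mpr (Finset.mem_range.mp ha)
  have hx : (a / c : ℝ) ∈ Set.Icc (0 : ℝ) 1 := ⟨by positivity, (div_le_one hc).mpr ha.le⟩
  have hev : ((Polynomial.bernoulli (n + 1)).map (algebraMap ℚ ℂ)).eval ((a / c : ℝ) : ℂ) =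
      (((Polynomial.bernoulli (n + 1)).eval ((a : ℚ) / (c : ℚ)) : ℚ) : ℂ) := by
    rw [show (((a / c : ℝ) : ℝ) : ℂ) = algebraMap ℚ ℂ ((a : ℚ) / c) by simp,
      Polynomial.eval_map_algebraMap, Polynomial.aeval_algebraMap_apply]
    simp
  rw [ZMod.toAddCircle_natCast, HurwitzZeta.hurwitzZeta_neg_nat hn hx, hev]
  ring

theorem primLFunction_one_sub_two_mul {N : ℕ} [NeZero N] (χ : DirichletCharacter ℂ N) {k : ℕ}
    (hk : 1 ≤ k) :
    primLFunction χ (1 - 2 * (k : ℂ)) =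
      -(genBernoulli χ.primitiveCharacter (2 * k)) / (2 * (k : ℂ)) := by
  have : NeZero χ.conductor := ⟨DirichletCharacter.conductor_ne_zero χ⟩
  obtain ⟨m, rfl⟩ := Nat.exists_eq_add_of_le' hk
  rw [primLFunction, show (1 : ℂ) - 2 * ((m + 1 : ℕ) : ℂ) = -((2 * m + 1 : ℕ) : ℂ) by
    push_cast; ring, χ.primitiveCharacter.LFunction_neg_natCast (by omega)]
  congr 1
  push_cast
  ring

theorem dedekindZeta_eq_prod_LFunctions
    (N : ℕ+) (F : IntermediateField ℚ (CyclotomicField N ℚ))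
    (e : ((CyclotomicField N ℚ) ≃ₐ[ℚ] (CyclotomicField N ℚ)) ≃* (ZMod (N : ℕ))ˣ)
    (he : ∀ σ : (CyclotomicField N ℚ) ≃ₐ[ℚ] (CyclotomicField N ℚ),
      ∀ ζ : CyclotomicField N ℚ, ζ ^ (N : ℕ) = 1 → σ ζ = ζ ^ ((e σ : ZMod (N : ℕ)).val))
    (Z : ℂ → ℂ) (hZ : IsDedekindZeta ↥F Z) :
    (∀ s : ℂ, s ≠ 1 →
      Z s = ∏ᶠ (χ : DirichletCharacter ℂ (N : ℕ))
        (_ : ∀ u : (ZMod (N : ℕ))ˣ,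
          u ∈ Subgroup.map e.toMonoidHom (IntermediateField.fixingSubgroup F) →
            χ (u : ZMod (N : ℕ)) = 1),
        primLFunction χ s) ∧
    ∀ k : ℕ, 1 ≤ k →
      Z (1 - 2 * (k : ℂ)) = ∏ᶠ (χ : DirichletCharacter ℂ (N : ℕ))
        (_ : ∀ u : (ZMod (N : ℕ))ˣ,
          u ∈ Subgroup.map e.toMonoidHom (IntermediateField.fixingSubgroup F) →
            χ (u : ZMod (N : ℕ)) = 1),
        (-(genBernoulli χ.primitiveCharacter (2 * k)) / (2 * (k : ℂ))) := by
  let := Fintype.ofFinite (DirichletCharacter ℂ (N : ℕ))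
  have : IsCyclotomicExtension {(N : ℕ)} ℚ (CyclotomicField (N : ℕ) ℚ) :=
    CyclotomicField.isCyclotomicExtension _ ℚ
  have := IsCyclotomicExtension.isAbelianGalois {(N : ℕ)} ℚ (CyclotomicField N ℚ)
  have : IsAbelianGalois ℚ F := .tower_bot ℚ F (CyclotomicField (N : ℕ) ℚ)
  have hprod (f : DirichletCharacter ℂ (N : ℕ) → ℂ) :
      (∏ᶠ (χ : DirichletCharacter ℂ (N : ℕ))
        (_ : ∀ u ∈ F.fixingSubgroup.map e.toMonoidHom, χ u = 1), f χ) =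
      ∏ χ : DirichletCharacter ℂ (N : ℕ) with
        (∀ u ∈ F.fixingSubgroup.map e.toMonoidHom, χ u = 1), f χ :=
    finprod_cond_eq_prod_of_cond_iff f fun _ ↦ by rw [Finset.mem_filter_univ]
  simp only [hprod]
  have key : ∀ s : ℂ, s ≠ 1 → Z s = ∏ χ : DirichletCharacter ℂ (N : ℕ) with
      (∀ u ∈ F.fixingSubgroup.map e.toMonoidHom, χ u = 1), primLFunction χ s := by
    refine eqOn_of_eqOn_one_lt_re hZ.1 (fun s hs ↦ ?_) fun s hs ↦ ?_
    · refine DifferentiableAt.fun_finsetProd fun χ _ ↦ ?_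
      have : NeZero χ.conductor := ⟨χ.conductor_ne_zero⟩
      exact χ.primitiveCharacter.differentiableAt_LFunction s (Or.inl hs)
    · have hs0 : s ≠ 0 := by
        rintro rfl
        norm_num at hs
      rw [hZ.2 s hs, NumberField.tsum_ne_bot_card_quotient_cpow_eq F hs0]
      exact NumberField.tsum_absNorm_cpow_eq_prod_primLFunction _ hs fun p hp ↦
        IsCyclotomicExtension.Rat.prod_primesOver_one_sub_eq he F s hp
  refine ⟨key, fun k hk ↦ ?_⟩
  rw [key _ fun h ↦ ?_]
  · exact Finset.prod_congr rfl fun χ _ ↦ primLFunction_one_sub_two_mul χ hk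
  · have : (k : ℂ) = 0 := by linear_combination -h / 2
    exact (Nat.one_le_iff_ne_zero.mp hk) (Nat.cast_eq_zero.mp this)
end
end
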